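/- Let k ≥ 2 and let P be the path graph with vertices v_1, …, v_{2k}, where v_i is adjacent to v_{i+1}. Consider the nonadaptive strategy S = (1, k, k−1, k, k−1, …, k, k−1) of length 2k−1 (a first term 1 followed by k−1 alternating pairs (k, k−1)) with start vertex v_1. Then exactly one play is consistent with S, and this play visits each of the 2k vertices of P exactly once. -/

import Mathlib

open SimpleGraph

variable {V : Type*}

/-- The eccentricity of a vertex: the maximum graph distance to any vertex. -/
noncomputable def ecc [Fintype V] (G : SimpleGraph V) (u : V) : ℕ :=
  Finset.univ.sup fun w => G.dist u w

/-- The diameter of a graph: the maximum eccentricity. -/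
noncomputable def graphDiam [Fintype V] (G : SimpleGraph V) : ℕ :=
  Finset.univ.sup fun u => ecc G u

/-- A nonempty set `U` of vertices is closed if for every `u ∈ U` and every vertex `v`
there is `x ∈ U` with `dist u v = dist u x`. -/
def IsClosedSet (G : SimpleGraph V) (U : Set V) : Prop :=
  U.Nonempty ∧ ∀ u ∈ U, ∀ v : V, ∃ x ∈ U, G.dist u v = G.dist u x

/-- An Explorer strategy (assigning a called distance to each history, most recent
vertex first) is valid if, whenever the current vertex `u` has a legal call available
(`1 ≤ ecc u`), it calls some `k` with `1 ≤ k ≤ ecc u`. -/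
def EValid [Fintype V] (G : SimpleGraph V) (ES : List V → ℕ) : Prop :=
  ∀ h : List V, ∀ u : V, h.head? = some u → 1 ≤ ecc G u →
    1 ≤ ES h ∧ ES h ≤ ecc G u

/-- A Director strategy is valid if, for each history with current vertex `u` and each
legal called distance `k` (`1 ≤ k ≤ ecc u`), it answers a vertex at distance exactly `k`. -/
def DValid [Fintype V] (G : SimpleGraph V) (DS : List V → ℕ → V) : Prop :=
  ∀ h : List V, ∀ u : V, h.head? = some u → ∀ k : ℕ, 1 ≤ k → k ≤ ecc G u →
    G.dist u (DS h k) = k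

/-- The history (most recent vertex first) of the first `n` moves of the play determined
by Explorer strategy `ES` and Director strategy `DS`, starting at `v`. -/
def play (ES : List V → ℕ) (DS : List V → ℕ → V) (v : V) : ℕ → List V
  | 0 => [v]
  | n + 1 => DS (play ES DS v n) (ES (play ES DS v n)) :: play ES DS v n

/-- The number of distinct vertices visited in the play determined by `ES` and `DS`
starting at `v`. -/
noncomputable def playScore (ES : List V → ℕ) (DS : List V → ℕ → V) (v : V) : ℕ :=
  Set.ncard {x : V | ∃ n : ℕ, x ∈ play ES DS v n}

/-- `fd G v` : the max over valid Explorer strategies of the min over valid Director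
strategies of the number of distinct vertices visited. -/
noncomputable def fd [Fintype V] (G : SimpleGraph V) (v : V) : ℕ :=
  sSup {r : ℕ | ∃ ES : List V → ℕ, EValid G ES ∧
    r = sInf {s : ℕ | ∃ DS : List V → ℕ → V, DValid G DS ∧ s = playScore ES DS v}}

/-- A play `x` is consistent with the nonadaptive strategy `S` from start `v` if it starts
at `v` and each step has the prescribed length. -/
def NAConsistent (G : SimpleGraph V) (S : List ℕ) (v : V) (x : ℕ → V) : Prop :=
  x 0 = v ∧ ∀ i < S.length, G.dist (x i) (x (i + 1)) = S.getD i 0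

/-- A nonadaptive strategy is playable from `v` if every consistent initial segment
can be extended. -/
def NAPlayable (G : SimpleGraph V) (S : List ℕ) (v : V) : Prop :=
  ∀ x : ℕ → V, ∀ i < S.length, x 0 = v →
    (∀ j < i, G.dist (x j) (x (j + 1)) = S.getD j 0) →
    ∃ y : V, G.dist (x i) y = S.getD i 0

/-- The score of a nonadaptive strategy `S` from `v`: the minimum over consistent plays
of the number of distinct vertices among `x 0, …, x S.length`. -/
noncomputable def naScore (G : SimpleGraph V) (S : List ℕ) (v : V) : ℕ :=
  sInf {k : ℕ | ∃ x : ℕ → V, NAConsistent G S v x ∧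
    k = Set.ncard {w : V | ∃ i ≤ S.length, x i = w}}

/-- The `n × m` grid graph: the box product of two path graphs. -/
def gridGraph (n m : ℕ) : SimpleGraph (Fin n × Fin m) :=
  (pathGraph n) □ (pathGraph m)

theorem pathGraph_walk_length_ge {n : ℕ} {u v : Fin n} (p : (pathGraph n).Walk u v) :
    (v : ℕ) - u + (u - v) ≤ p.length := by
  induction p with
  | nil => simp
  | cons h p ih =>
    rw [pathGraph_adj] at h
    rw [Walk.length_cons]
    omega

theorem pathGraph_exists_walk_add {n : ℕ} (u : Fin n) (d : ℕ) (h : u + d < n) :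
    ∃ p : (pathGraph n).Walk u ⟨u + d, h⟩, p.length = d := by
  induction d with
  | zero => exact ⟨Walk.nil, rfl⟩
  | succ d ih =>
    obtain ⟨p, hp⟩ := ih (by omega)
    refine ⟨p.concat (pathGraph_adj.2 (Or.inl rfl)), ?_⟩
    rw [Walk.length_concat, hp]

theorem pathGraph_dist_of_le {n : ℕ} {u v : Fin n} (h : u ≤ v) :
    (pathGraph n).dist u v = v - u := by
  have huv : (u : ℕ) ≤ v := h
  obtain ⟨p, hp⟩ := pathGraph_exists_walk_add u (v - u) (by omega)
  have hv : (⟨u + (v - u), by omega⟩ : Fin n) = v := Fin.ext (Nat.add_sub_cancel' huv)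
  have hle := dist_le p
  rw [hp, hv] at hle
  obtain ⟨q, hq⟩ := ((pathGraph_preconnected n) u v).exists_walk_length_eq_dist
  have hge := pathGraph_walk_length_ge q
  omega

/-- Graph distance on the path is `|u - v|`, written with truncated subtraction. -/
theorem pathGraph_dist {n : ℕ} (u v : Fin n) :
    (pathGraph n).dist u v = (v : ℕ) - u + (u - v) := by
  rcases le_total u v with h | h
  · have huv : (u : ℕ) ≤ v := h
    rw [pathGraph_dist_of_le h]
    omega
  · have hvu : (v : ℕ) ≤ u := h
    rw [dist_comm, pathGraph_dist_of_le h]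
    omega

theorem getD_flatten_replicate_pair (a b m j : ℕ) (hj : j < m) :
    (List.replicate m [a, b]).flatten.getD (2 * j) 0 = a ∧
      (List.replicate m [a, b]).flatten.getD (2 * j + 1) 0 = b := by
  induction m generalizing j with
  | zero => omega
  | succ m ih =>
    cases j with
    | zero => simp [List.replicate_succ]
    | succ j =>
      simpa [List.replicate_succ, Nat.mul_succ] using ih j (by omega)

theorem length_cons_flatten_replicate_pair (c a b m : ℕ) :
    (c :: (List.replicate m [a, b]).flatten).length = 2 * m + 1 := by
  simp [mul_comm]

/-- The position (counted from `0`) after `i` moves in the play that calls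
`1, k, k - 1, k, k - 1, …` from an end of the path on `2 * k` vertices. -/
def zigzag (k i : ℕ) : ℕ :=
  if i = 0 then 0 else if i % 2 = 1 then (i + 1) / 2 else k + i / 2

theorem zigzag_odd (k j : ℕ) : zigzag k (2 * j + 1) = j + 1 := by
  rw [zigzag, if_neg (by omega), if_pos (by omega)]
  omega

theorem zigzag_even (k j : ℕ) : zigzag k (2 * j + 1 + 1) = k + j + 1 := by
  rw [zigzag, if_neg (by omega), if_neg (by omega)]
  omega

theorem zigzag_lt {k i : ℕ} (hi : i < 2 * k) : zigzag k i < 2 * k := by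
  unfold zigzag
  split_ifs <;> omega

theorem eq_of_zigzag_eq {k i j : ℕ} (hi : i < 2 * k) (hj : j < 2 * k)
    (h : zigzag k i = zigzag k j) : i = j := by
  unfold zigzag at h
  split_ifs at h <;> omega

theorem naConsistent_iff_eq_zigzag (k : ℕ) (hk : 0 < 2 * k) (x : ℕ → Fin (2 * k)) :
    NAConsistent (pathGraph (2 * k)) (1 :: (List.replicate (k - 1) [k, k - 1]).flatten)
        ⟨0, hk⟩ x ↔ ∀ i < 2 * k, (x i : ℕ) = zigzag k i := by
  have hstep (j : ℕ) (hj : j < k - 1) := getD_flatten_replicate_pair k (k - 1) (k - 1) j hj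
  unfold NAConsistent
  rw [length_cons_flatten_replicate_pair]
  simp only [pathGraph_dist]
  constructor
  · rintro ⟨h0, h⟩ i hi
    induction i with
    | zero => simp [h0, zigzag]
    | succ i ih =>
      have hd := h i (by omega)
      have hx := ih (by omega)
      have hlt := (x (i + 1)).isLt
      rcases i with _ | i
      · simp [h0] at hd
        simp [zigzag, hd]
      · rw [List.getD_cons_succ] at hd
        rcases Nat.even_or_odd' i with ⟨j, rfl | rfl⟩
        · rw [(hstep j (by omega)).1] at hd
          rw [zigzag_odd] at hx
          rw [zigzag_even]
          omega
        · rw [(hstep j (by omega)).2] at hd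
          rw [zigzag_even] at hx
          rw [show zigzag k (2 * j + 1 + 1 + 1) = j + 1 + 1 from zigzag_odd k (j + 1)]
          omega
  · intro h
    refine ⟨Fin.ext (by simp [h 0 hk, zigzag]), fun i hi => ?_⟩
    rw [h i (by omega), h (i + 1) (by omega)]
    rcases i with _ | i
    · simp [zigzag]
    · rw [List.getD_cons_succ]
      rcases Nat.even_or_odd' i with ⟨j, rfl | rfl⟩
      · rw [(hstep j (by omega)).1, zigzag_odd, zigzag_even]
        omega
      · rw [(hstep j (by omega)).2, zigzag_even,
          show zigzag k (2 * j + 1 + 1 + 1) = j + 1 + 1 from zigzag_odd k (j + 1)]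
        omega

/-- On the path graph with `2k` vertices (`k ≥ 2`), the nonadaptive
strategy `S = (1, k, k-1, k, k-1, …, k, k-1)` (a `1` followed by `k-1` pairs `(k, k-1)`)
started at `v_1` admits exactly one consistent play, and this play visits each of the
`2k` vertices exactly once. -/
theorem stmt_18 (k : ℕ) (hk : 2 ≤ k) :
    (∃ x : ℕ → Fin (2 * k),
      NAConsistent (pathGraph (2 * k)) (1 :: (List.replicate (k - 1) [k, k - 1]).flatten)
        ⟨0, by omega⟩ x) ∧
    (∀ x y : ℕ → Fin (2 * k),
      NAConsistent (pathGraph (2 * k)) (1 :: (List.replicate (k - 1) [k, k - 1]).flatten)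
        ⟨0, by omega⟩ x →
      NAConsistent (pathGraph (2 * k)) (1 :: (List.replicate (k - 1) [k, k - 1]).flatten)
        ⟨0, by omega⟩ y →
      ∀ i ≤ 2 * k - 1, x i = y i) ∧
    (∀ x : ℕ → Fin (2 * k),
      NAConsistent (pathGraph (2 * k)) (1 :: (List.replicate (k - 1) [k, k - 1]).flatten)
        ⟨0, by omega⟩ x →
      Function.Bijective fun i : Fin (2 * k) => x (i : ℕ)) := by
  have hpos : 0 < 2 * k := by omega
  simp only [naConsistent_iff_eq_zigzag k hpos]
  refine ⟨⟨fun i => ⟨zigzag k i % (2 * k), Nat.mod_lt _ hpos⟩,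
    fun i hi => Nat.mod_eq_of_lt (zigzag_lt hi)⟩,
    fun x y hx hy i hi => Fin.ext ?_, fun x hx => ?_⟩
  · rw [hx i (by omega), hy i (by omega)]
  · refine Finite.injective_iff_bijective.1 fun i j hij => Fin.ext ?_
    have hval := congrArg Fin.val hij
    simp only [hx _ i.isLt, hx _ j.isLt] at hval
    exact eq_of_zigzag_eq i.isLt j.isLt hval
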